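/- For every integer k ≥ 1, set n = 2^{k+1}. There exists a rationalizable laminar data set T over an n × n strategy space (namely a 2-regular data set, whose subgames are pairwise disjoint) such that every bimatrix game (A,B) that rationalizes T satisfies rank(A+B) ≥ √(n/2). -/

import Mathlib

/-- An observation: an observed choice `(i,j)` together with a subgame `(I,J)`. -/
abbrev Obs (n : ℕ) := (Fin n × Fin n) × Finset (Fin n) × Finset (Fin n)

/-- `T` is a (well-formed) data set: each observed choice lies in its subgame. -/
def IsDataset {n : ℕ} (T : Finset (Obs n)) : Prop :=
  ∀ o ∈ T, o.1.1 ∈ o.2.1 ∧ o.1.2 ∈ o.2.2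

/-- `(i,j)` is a strict Nash equilibrium of the subgame `(I,J)` of the bimatrix game `(A,B)`:
`A i j > A i' j` for all other `i' ∈ I` and `B i j > B i j'` for all other `j' ∈ J`. -/
def StrictNash {n : ℕ} (A B : Matrix (Fin n) (Fin n) ℝ)
    (I J : Finset (Fin n)) (i j : Fin n) : Prop :=
  i ∈ I ∧ j ∈ J ∧ (∀ i' ∈ I, i' ≠ i → A i' j < A i j) ∧ (∀ j' ∈ J, j' ≠ j → B i j' < B i j)

/-- The bimatrix game `(A,B)` rationalizes the data set `T`: every observed choice is a
strict Nash equilibrium of its subgame. -/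
def Rationalizes {n : ℕ} (A B : Matrix (Fin n) (Fin n) ℝ) (T : Finset (Obs n)) : Prop :=
  ∀ o ∈ T, StrictNash A B o.2.1 o.2.2 o.1.1 o.1.2

/-- The data set `T` is rationalizable by some bimatrix game. -/
def Rationalizable {n : ℕ} (T : Finset (Obs n)) : Prop :=
  ∃ A B : Matrix (Fin n) (Fin n) ℝ, Rationalizes A B T

/-- Two subgames `(I,J)` and `(I',J')` cross: `(I×J) ∩ (I'×J') ≠ ∅` but neither product
set contains the other. -/
def Cross {n : ℕ} (S S' : Finset (Fin n) × Finset (Fin n)) : Prop :=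
  ((S.1 ×ˢ S.2) ∩ (S'.1 ×ˢ S'.2)).Nonempty ∧
    ¬ (S.1 ×ˢ S.2 ⊆ S'.1 ×ˢ S'.2) ∧ ¬ (S'.1 ×ˢ S'.2 ⊆ S.1 ×ˢ S.2)

/-- A data set is laminar if no two of its subgames cross. -/
def Laminar {n : ℕ} (T : Finset (Obs n)) : Prop :=
  ∀ o ∈ T, ∀ o' ∈ T, ¬ Cross o.2 o'.2

/-- The `t`-th element (`t ∈ {0,1}`) of the `a`-th pair of strategies in `[2m]`
(0-based; this is strategy `2a+1+t` in the 1-based numbering of the paper). -/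
def dbl {m : ℕ} (a : Fin m) (t : Fin 2) : Fin (2 * m) :=
  ⟨2 * a.1 + t.1, by have := a.isLt; have := t.isLt; omega⟩

/-- The `a`-th pair of strategies `{2a-1, 2a}` (1-based), as a subset of `[2m]`. -/
def pairF {m : ℕ} (a : Fin m) : Finset (Fin (2 * m)) := {dbl a 0, dbl a 1}

/-- A 2-regular data set: the subgames appearing in `T` are exactly the pairs
`(pairF a, pairF b)`, and for each such subgame the observed choices are exactly the two
diagonal profiles, or exactly the two off-diagonal profiles (but not both). -/
def TwoRegular {m : ℕ} (T : Finset (Obs (2 * m))) : Prop :=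
  (∀ o ∈ T, ∃ a b : Fin m, o.2 = (pairF a, pairF b)) ∧
  ∀ a b : Fin m,
    ({p : Fin (2 * m) × Fin (2 * m) | (p, pairF a, pairF b) ∈ T}
        = ({(dbl a 0, dbl b 0), (dbl a 1, dbl b 1)} : Set (Fin (2 * m) × Fin (2 * m)))) ∨
    ({p : Fin (2 * m) × Fin (2 * m) | (p, pairF a, pairF b) ∈ T}
        = ({(dbl a 0, dbl b 1), (dbl a 1, dbl b 0)} : Set (Fin (2 * m) × Fin (2 * m))))

section SignRank

open Matrix

/-- A positive semidefinite perturbation of the identity does not decrease the determinant. -/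
theorem Matrix.PosSemidef.one_le_det_one_add {d : ℕ} {N : Matrix (Fin d) (Fin d) ℝ}
    (hN : N.PosSemidef) : 1 ≤ (1 + N).det := by
  have h := congrArg (Polynomial.eval (-1)) hN.isHermitian.charpoly_eq
  rw [Matrix.eval_charpoly, Polynomial.eval_prod] at h
  have h1 : (scalar (Fin d)) (-1 : ℝ) - N = -(1 + N) := by
    rw [map_neg, map_one]; abel
  rw [h1, Matrix.det_neg] at h
  have h2 : (∏ j, Polynomial.eval (-1)
      (Polynomial.X - Polynomial.C (hN.isHermitian.eigenvalues j : ℝ))) =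
      (-1) ^ Fintype.card (Fin d) * ∏ j, (1 + hN.isHermitian.eigenvalues j) := by
    rw [← Finset.card_univ, ← Finset.prod_const, ← Finset.prod_mul_distrib]
    refine Finset.prod_congr rfl fun j _ => ?_
    simp; ring
  have h3 : (1 + N).det = ∏ j, (1 + hN.isHermitian.eigenvalues j) := by
    have := h.trans h2
    exact mul_left_cancel₀ (pow_ne_zero _ (by norm_num)) this
  rw [h3]
  calc (1 : ℝ) = ∏ _j : Fin d, 1 := by simp
    _ ≤ _ := Finset.prod_le_prod (by simp) fun j _ => by
      linarith [hN.eigenvalues_nonneg j]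

theorem Matrix.sq_det_submatrix_le_det_transpose_mul_self {m d : ℕ}
    (W : Matrix (Fin m) (Fin d) ℝ) {f : Fin d → Fin m} (hf : Function.Injective f) :
    (W.submatrix f id).det ^ 2 ≤ (Wᵀ * W).det := by
  classical
  set F := W.submatrix f id with hF
  by_cases h0 : F.det = 0
  · rw [h0]
    simpa using (Matrix.posSemidef_conjTranspose_mul_self W).det_nonneg
  have hu : IsUnit F.det := isUnit_iff_ne_zero.2 h0
  set R : Matrix (Fin m) (Fin d) ℝ :=
    Matrix.of fun a j => if a ∈ Set.range f then 0 else W a j with hR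
  have hsplit : Wᵀ * W = Fᵀ * F + Rᵀ * R := by
    ext i j
    simp only [Matrix.mul_apply, Matrix.add_apply, Matrix.transpose_apply, hF, hR,
      Matrix.submatrix_apply, id, Matrix.of_apply]
    rw [← Finset.sum_filter_add_sum_filter_not Finset.univ (fun a => a ∈ Set.range f)]
    congr 1
    · rw [← Finset.sum_image (f := fun a => W a i * W a j) (g := f) (fun x _ y _ h => hf h)]
      refine Finset.sum_congr ?_ fun _ _ => rfl
      ext a; simp
    · rw [Finset.sum_filter]
      refine Finset.sum_congr rfl fun a _ => ?_
      by_cases h : a ∈ Set.range f <;> simp [h]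
  have hfac : Wᵀ * W = Fᵀ * (1 + (R * F⁻¹)ᵀ * (R * F⁻¹)) * F := by
    have e1 : F⁻¹ * F = 1 := Matrix.nonsing_inv_mul F hu
    have e2 : Fᵀ * F⁻¹ᵀ = 1 := by rw [← Matrix.transpose_mul, e1, Matrix.transpose_one]
    rw [hsplit, Matrix.transpose_mul, Matrix.mul_add, Matrix.add_mul, Matrix.mul_one]
    congr 1
    calc Rᵀ * R = (Fᵀ * F⁻¹ᵀ) * (Rᵀ * R) * (F⁻¹ * F) := by rw [e1, e2]; simp
      _ = _ := by simp only [Matrix.mul_assoc]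
  rw [hfac, Matrix.det_mul, Matrix.det_mul, Matrix.det_transpose]
  have := (Matrix.posSemidef_conjTranspose_mul_self (R * F⁻¹)).one_le_det_one_add
  rw [Matrix.conjTranspose_eq_transpose_of_trivial] at this
  nlinarith [sq_nonneg F.det]

/-- Among all subsets of given size some one has at least the average sum. -/
theorem Finset.exists_subset_card_mul_sum_le {α : Type*} [DecidableEq α] (s : Finset α)
    (t : α → ℝ) {d : ℕ} (hd : d ≤ s.card) :
    ∃ S ⊆ s, S.card = d ∧ (d : ℝ) * ∑ a ∈ s, t a ≤ s.card * ∑ a ∈ S, t a := by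
  induction hd using Nat.decreasingInduction with
  | self => exact ⟨s, subset_rfl, rfl, le_rfl⟩
  | of_succ e he ih =>
    obtain ⟨S, hSs, hSc, hS⟩ := ih
    obtain ⟨a, haS, ha⟩ := S.exists_min_image t (Finset.card_pos.1 (by omega))
    refine ⟨S.erase a, (S.erase_subset a).trans hSs, by rw [Finset.card_erase_of_mem haS]; omega, ?_⟩
    have h1 := Finset.card_nsmul_le_sum S t (t a) ha
    have h2 := Finset.add_sum_erase S t haS
    rw [hSc, nsmul_eq_mul] at h1
    push_cast at h1 hS
    have hs : (0 : ℝ) ≤ s.card := Nat.cast_nonneg _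
    have he0 : (0 : ℝ) ≤ e := Nat.cast_nonneg _
    have h3 : (e : ℝ) * ∑ a ∈ S, t a ≤ (e + 1) * ∑ x ∈ S.erase a, t x := by
      rw [← h2] at h1 ⊢
      linarith
    have h4 : (e : ℝ) * ((e + 1) * ∑ a ∈ s, t a) ≤ e * (s.card * ∑ a ∈ S, t a) :=
      mul_le_mul_of_nonneg_left hS he0
    have h5 := mul_le_mul_of_nonneg_left h3 hs
    have : ((e : ℝ) + 1) * (e * ∑ a ∈ s, t a) ≤ (e + 1) * (s.card * ∑ x ∈ S.erase a, t x) := by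
      linarith
    exact le_of_mul_le_mul_left this (by positivity)

theorem exists_injective_prod_pow_le {m d : ℕ} (hd : d ≤ m) (x : Fin m → ℝ) (hx : ∀ a, 0 < x a) :
    ∃ f : Fin d → Fin m, Function.Injective f ∧ (∏ a, x a) ^ d ≤ (∏ i, x (f i)) ^ m := by
  obtain ⟨S, -, hSc, hS⟩ := (Finset.univ : Finset (Fin m)).exists_subset_card_mul_sum_le
    (fun a => Real.log (x a)) (d := d) (by simpa using hd)
  refine ⟨S.orderEmbOfFin hSc, (S.orderEmbOfFin hSc).injective, ?_⟩
  have hp : ∏ i, x (S.orderEmbOfFin hSc i) = ∏ a ∈ S, x a := by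
    rw [← Finset.prod_image (f := x) (g := S.orderEmbOfFin hSc)
      (fun i _ j _ h => (S.orderEmbOfFin hSc).injective h)]
    congr 1
    rw [← Finset.coe_inj]
    simp
  rw [hp]
  rw [← Real.log_le_log_iff (pow_pos (Finset.prod_pos fun a _ => hx a) _)
    (pow_pos (Finset.prod_pos fun a _ => hx a) _), Real.log_pow, Real.log_pow,
    Real.log_prod (fun a _ => (hx a).ne'), Real.log_prod (fun a _ => (hx a).ne')]
  simpa using hS

theorem Matrix.one_le_sum_sq_diag_of_isIdempotent {m : ℕ} {K Y H : Matrix (Fin m) (Fin m) ℝ}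
    (hm : 0 < m) (hKs : Kᵀ = K) (hKK : K * K = K) (hKY : K * Y = Y)
    (hH : ∀ a b, |H a b| = 1) (hHH : H * Hᵀ = (m : ℝ) • (1 : Matrix (Fin m) (Fin m) ℝ))
    (hpos : ∀ a b, 0 < H a b * Y a b) : 1 ≤ ∑ a, K a a ^ 2 := by
  have hKsym : ∀ a c, K a c = K c a := fun a c => congrFun (congrFun hKs c) a
  have hKd : ∀ a, K a a = ∑ c, K a c ^ 2 := fun a => by
    conv_lhs => rw [← hKK]
    rw [Matrix.mul_apply]
    exact Finset.sum_congr rfl fun c _ => by rw [hKsym c a, sq]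
  have hKnn : ∀ a, 0 ≤ K a a := fun a => by
    rw [hKd]; exact Finset.sum_nonneg fun c _ => sq_nonneg _
  set z : Matrix (Fin m) (Fin m) ℝ := Matrix.of fun a b => √(K a a) * H a b with hz
  have hYabs : ∀ a b, H a b * Y a b = |Y a b| := fun a b => by
    rw [← abs_of_pos (hpos a b), abs_mul, hH, one_mul]
  have hcol : ∀ b, 1 ≤ ∑ c, (K * z) c b ^ 2 := fun b => by
    set N := ∑ a, Y a b ^ 2 with hN
    have hN0 : 0 < N := Finset.sum_pos (fun a _ => by
      have : Y a b ≠ 0 := fun h => by simpa [h] using hpos a b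
      positivity) ⟨⟨0, hm⟩, Finset.mem_univ _⟩
    set S := ∑ a, √(K a a) * |Y a b| with hS
    have hrow : ∀ a, |Y a b| ≤ √(K a a) * √N := fun a => by
      rw [← Real.sqrt_mul (hKnn a)]
      refine Real.abs_le_sqrt ?_
      have : Y a b = ∑ c, K a c * Y c b := by
        conv_lhs => rw [← hKY]
        rw [Matrix.mul_apply]
      rw [this, hKd]
      exact Finset.sum_mul_sq_le_sq_mul_sq _ _ _
    have h1 : N ≤ √N * S := by
      rw [hN, hS, Finset.mul_sum]
      refine Finset.sum_le_sum fun a _ => ?_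
      rw [← sq_abs, sq]
      calc |Y a b| * |Y a b| ≤ (√(K a a) * √N) * |Y a b| :=
            mul_le_mul_of_nonneg_right (hrow a) (abs_nonneg _)
        _ = _ := by ring
    have h2 : S = ∑ c, (K * z) c b * Y c b := by
      have e : Yᵀ * z = Yᵀ * (K * z) := by
        conv_lhs => rw [← hKY, Matrix.transpose_mul, hKs, Matrix.mul_assoc]
      have := congrFun (congrFun e b) b
      rw [Matrix.mul_apply, Matrix.mul_apply] at this
      rw [hS]
      calc _ = ∑ j, Yᵀ b j * z j b := Finset.sum_congr rfl fun a _ => by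
            rw [← hYabs]; simp [hz]; ring
        _ = _ := this
        _ = _ := Finset.sum_congr rfl fun a _ => by simp [mul_comm]
    have h3 : S ^ 2 ≤ (∑ c, (K * z) c b ^ 2) * N := by
      rw [h2]; exact Finset.sum_mul_sq_le_sq_mul_sq _ _ _
    have h4 : N ^ 2 ≤ N * S ^ 2 := by
      calc N ^ 2 ≤ (√N * S) ^ 2 := pow_le_pow_left₀ hN0.le h1 2
        _ = N * S ^ 2 := by rw [mul_pow, Real.sq_sqrt hN0.le]
    have h5 : N ≤ S ^ 2 := le_of_mul_le_mul_left (by rwa [← sq]) hN0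
    have h6 : 1 * N ≤ (∑ c, (K * z) c b ^ 2) * N := by linarith
    exact le_of_mul_le_mul_right h6 hN0
  have hzz : ∀ a c, (z * zᵀ) a c = if a = c then m * K a a else 0 := fun a c => by
    have := congrFun (congrFun hHH a) c
    rw [Matrix.mul_apply] at this
    rw [Matrix.mul_apply]
    calc _ = √(K a a) * √(K c c) * ∑ j, H a j * Hᵀ j c := by
          rw [Finset.mul_sum]
          exact Finset.sum_congr rfl fun j _ => by simp [hz]; ring
      _ = _ := by
          rw [this]
          by_cases h : a = c
          · subst h
            simp [Real.mul_self_sqrt (hKnn a), mul_comm]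
          · simp [h]
  have htot : ∑ b, ∑ c, (K * z) c b ^ 2 = m * ∑ a, K a a ^ 2 := by
    have e : (K * z) * (K * z)ᵀ = K * (z * zᵀ) * K := by
      rw [Matrix.transpose_mul, hKs]; simp only [Matrix.mul_assoc]
    have e2 : ∑ b, ∑ c, (K * z) c b ^ 2 = ((K * z) * (K * z)ᵀ).trace := by
      rw [Finset.sum_comm]
      simp only [Matrix.trace, Matrix.diag, Matrix.mul_apply (M := K * z), Matrix.transpose_apply, sq]
    have e3 : z * zᵀ = Matrix.diagonal fun a => m * K a a := by
      ext a c; rw [hzz, Matrix.diagonal_apply]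
    rw [e2, e, Matrix.trace_mul_comm, ← Matrix.mul_assoc, hKK, e3, Finset.mul_sum]
    simp only [Matrix.trace, Matrix.diag, Matrix.mul_diagonal]
    exact Finset.sum_congr rfl fun a _ => by ring
  have hm' : (0 : ℝ) < m := by exact_mod_cast hm
  have : (m : ℝ) * 1 ≤ m * ∑ a, K a a ^ 2 := by
    rw [← htot]
    calc (m : ℝ) * 1 = ∑ _b : Fin m, (1 : ℝ) := by simp
      _ ≤ _ := Finset.sum_le_sum fun b _ => hcol b
  exact le_of_mul_le_mul_left this hm'

/-- Rank factorization over the rank. -/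
theorem Matrix.exists_eq_mul_of_rank {n : ℕ} (C : Matrix (Fin n) (Fin n) ℝ) :
    ∃ (U : Matrix (Fin n) (Fin C.rank) ℝ) (V : Matrix (Fin C.rank) (Fin n) ℝ), C = U * V := by
  generalize hr : C.rank = r
  let b := Module.finBasisOfFinrankEq ℝ (LinearMap.range C.mulVecLin) hr
  refine ⟨Matrix.of fun i j => (b j : Fin n → ℝ) i,
    Matrix.of fun j k => b.repr ⟨C.mulVecLin (Pi.single k 1), LinearMap.mem_range_self _ _⟩ j, ?_⟩
  ext i k
  have h := congrArg Subtype.val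
    (b.sum_repr ⟨C.mulVecLin (Pi.single k 1), LinearMap.mem_range_self _ _⟩)
  have h' := congrFun h i
  simp only [Submodule.coe_sum, Submodule.coe_smul, Finset.sum_apply, Pi.smul_apply, smul_eq_mul,
    Matrix.mulVecLin_apply, Matrix.mulVec_single_one, Matrix.col_apply] at h'
  rw [← h', Matrix.mul_apply]
  exact Finset.sum_congr rfl fun j _ => by simp [mul_comm]

theorem exists_hadamard (k : ℕ) : ∃ H : Matrix (Fin (2 ^ k)) (Fin (2 ^ k)) ℝ,
    (∀ a b, H a b = 1 ∨ H a b = -1) ∧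
      H * Hᵀ = ((2 ^ k : ℕ) : ℝ) • (1 : Matrix (Fin (2 ^ k)) (Fin (2 ^ k)) ℝ) := by
  let h : Fin 2 → Fin 2 → ℝ := fun s t => if s = 1 ∧ t = 1 then -1 else 1
  let e := (finFunctionFinEquiv (m := 2) (n := k)).symm
  refine ⟨Matrix.of fun a b => ∏ i, h (e a i) (e b i), fun a b => ?_, ?_⟩
  · rw [Matrix.of_apply]
    refine Finset.prod_induction _ (fun x : ℝ => x = 1 ∨ x = -1) ?_ (Or.inl rfl) fun i _ => ?_
    · rintro x y (rfl | rfl) (rfl | rfl) <;> simp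
    · by_cases c : e a i = 1 ∧ e b i = 1 <;> simp [h, c]
  · have hh : ∀ s s', ∑ t, h s t * h s' t = if s = s' then 2 else 0 := by
      intro s s'
      fin_cases s <;> fin_cases s' <;> norm_num [h, Fin.sum_univ_two]
    ext a c
    simp only [Matrix.mul_apply, Matrix.transpose_apply, Matrix.of_apply, ← Finset.prod_mul_distrib]
    rw [Equiv.sum_comp e fun x => ∏ i, h (e a i) (x i) * h (e c i) (x i),
      ← Fintype.prod_sum fun i t => h (e a i) t * h (e c i) t]
    simp only [hh, Matrix.smul_apply, Matrix.one_apply, smul_eq_mul]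
    by_cases hac : a = c
    · subst hac; simp
    · rw [if_neg hac, mul_zero]
      have : e a ≠ e c := fun h => hac (e.injective h)
      obtain ⟨i, hi⟩ := Function.ne_iff.1 this
      exact Finset.prod_eq_zero (Finset.mem_univ i) (if_neg hi)

/-- Effect on the Gram determinant of rescaling one row, in terms of its leverage score. -/
theorem Matrix.det_gram_update {m d : ℕ} {W : Matrix (Fin m) (Fin d) ℝ}
    (h0 : (Wᵀ * W).det ≠ 0) (a : Fin m) (σ : ℝ) :
    ((W.updateRow a (σ • W a))ᵀ * W.updateRow a (σ • W a)).det =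
      (Wᵀ * W).det * (1 - (1 - σ ^ 2) * (W * (Wᵀ * W)⁻¹ * Wᵀ) a a) := by
  have e : (W.updateRow a (σ • W a))ᵀ * W.updateRow a (σ • W a) =
      Wᵀ * W + replicateCol Unit ((σ ^ 2 - 1) • W a) * replicateRow Unit (W a) := by
    ext i j
    simp only [Matrix.mul_apply, Matrix.add_apply, Matrix.transpose_apply, Matrix.replicateCol_apply,
      Matrix.replicateRow_apply, Finset.univ_unique, Finset.sum_singleton, Pi.smul_apply, smul_eq_mul]
    rw [← Finset.add_sum_erase _ _ (Finset.mem_univ a),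
      ← Finset.add_sum_erase _ (fun x => W x i * W x j) (Finset.mem_univ a)]
    have : ∑ x ∈ Finset.univ.erase a, W.updateRow a (σ • W a) x i * W.updateRow a (σ • W a) x j =
        ∑ x ∈ Finset.univ.erase a, W x i * W x j := Finset.sum_congr rfl fun x hx => by
      rw [Matrix.updateRow_ne (Finset.ne_of_mem_erase hx)]
    rw [this]
    simp only [Matrix.updateRow_self, Pi.smul_apply, smul_eq_mul]
    ring
  rw [e, Matrix.det_add_replicateCol_mul_replicateRow (isUnit_iff_ne_zero.2 h0), Matrix.det_unique (n := Unit)]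
  congr 1
  simp only [Matrix.add_apply, Matrix.one_apply_eq]
  rw [sub_eq_add_neg]
  congr 1
  simp only [Matrix.mul_apply, Matrix.replicateCol_apply, Matrix.replicateRow_apply,
    Matrix.transpose_apply, Pi.smul_apply, smul_eq_mul, Finset.mul_sum]
  rw [← Finset.sum_neg_distrib]
  exact Finset.sum_congr rfl fun x _ => by ring

theorem exists_pos_le_sq_det_submatrix {m d : ℕ} {U : Matrix (Fin m) (Fin d) ℝ}
    (hU : ∀ f : Fin d → Fin m, Function.Injective f → (U.submatrix f id).det ≠ 0) :
    ∃ c : ℝ, 0 < c ∧ ∀ f : Fin d → Fin m, Function.Injective f →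
      c ≤ (U.submatrix f id).det ^ 2 := by
  classical
  let s : Finset (Fin d → Fin m) := {f | Function.Injective f}
  rcases s.eq_empty_or_nonempty with hs | hs
  · refine ⟨1, one_pos, fun f hf => ?_⟩
    have : f ∈ s := by simpa [s] using hf
    simp [hs] at this
  · obtain ⟨f, hf, h⟩ := s.exists_min_image (fun f => (U.submatrix f id).det ^ 2) hs
    refine ⟨_, ?_, fun g hg => h g (by simpa [s] using hg)⟩
    have := hU f (by simpa [s] using hf)
    positivity

/-- Approximate minimizers of the scale-invariant Gram determinant under row scalings. -/
theorem exists_approx_scaling {m d : ℕ} (hd : d ≤ m) {U : Matrix (Fin m) (Fin d) ℝ}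
    (hU : ∀ f : Fin d → Fin m, Function.Injective f → (U.submatrix f id).det ≠ 0)
    {η : ℝ} (hη : 0 < η) :
    ∃ y : Fin m → ℝ, (∀ a, 0 < y a) ∧
      0 < ((diagonal y * U)ᵀ * (diagonal y * U)).det ∧
      ∀ z : Fin m → ℝ, (∀ a, 0 < z a) →
        (1 - η) * (((diagonal y * U)ᵀ * (diagonal y * U)).det ^ m / (∏ a, y a ^ 2) ^ d) ≤
          ((diagonal z * U)ᵀ * (diagonal z * U)).det ^ m / (∏ a, z a ^ 2) ^ d := by
  obtain ⟨c, hc, hcU⟩ := exists_pos_le_sq_det_submatrix hU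
  let P : (Fin m → ℝ) → ℝ := fun y => ((diagonal y * U)ᵀ * (diagonal y * U)).det
  let F : (Fin m → ℝ) → ℝ := fun y => P y ^ m / (∏ a, y a ^ 2) ^ d
  have key : ∀ y : Fin m → ℝ, (∀ a, 0 < y a) → 0 < P y ∧ c ^ m ≤ F y := by
    intro y hy
    obtain ⟨f, hf, hfy⟩ := exists_injective_prod_pow_le hd (fun a => y a ^ 2)
      (fun a => pow_pos (hy a) 2)
    have h1 := Matrix.sq_det_submatrix_le_det_transpose_mul_self (diagonal y * U) hf
    have h2 : (diagonal y * U).submatrix f id = diagonal (fun i => y (f i)) * U.submatrix f id := by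
      ext i j; simp [Matrix.diagonal_mul]
    rw [h2, Matrix.det_mul, Matrix.det_diagonal, mul_pow, ← Finset.prod_pow] at h1
    have h3 : 0 < ∏ i, y (f i) ^ 2 := Finset.prod_pos fun i _ => pow_pos (hy _) 2
    have h4 : (∏ i, y (f i) ^ 2) * c ≤ P y :=
      (mul_le_mul_of_nonneg_left (hcU f hf) h3.le).trans h1
    refine ⟨(mul_pos h3 hc).trans_le h4, ?_⟩
    have h5 : 0 < ∏ a, y a ^ 2 := Finset.prod_pos fun i _ => pow_pos (hy _) 2
    rw [le_div_iff₀ (pow_pos h5 d)]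
    calc c ^ m * (∏ a, y a ^ 2) ^ d ≤ c ^ m * (∏ i, y (f i) ^ 2) ^ m := by gcongr
      _ = ((∏ i, y (f i) ^ 2) * c) ^ m := by rw [mul_pow, mul_comm]
      _ ≤ P y ^ m := pow_le_pow_left₀ (mul_pos h3 hc).le h4 m
  let S : Set ℝ := F '' {y | ∀ a, 0 < y a}
  have hSb : BddBelow S := ⟨c ^ m, by rintro _ ⟨y, hy, rfl⟩; exact (key y hy).2⟩
  have hSne : S.Nonempty := ⟨_, fun _ => 1, fun _ => one_pos, rfl⟩
  have hpos : 0 < sInf S := (pow_pos hc m).trans_le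
    (le_csInf hSne (by rintro _ ⟨y, hy, rfl⟩; exact (key y hy).2))
  obtain ⟨_, ⟨y, hy, rfl⟩, hlt⟩ := exists_lt_of_csInf_lt hSne
    (show sInf S < (1 + η) * sInf S by nlinarith)
  refine ⟨y, hy, (key y hy).1, fun z hz => ?_⟩
  change (1 - η) * F y ≤ F z
  have hz' : sInf S ≤ F z := csInf_le hSb ⟨z, hz, rfl⟩
  have hF : 0 < F y := (pow_pos hc m).trans_le (key y hy).2
  rcases le_or_gt 1 η with h | h
  · nlinarith [pow_pos hc m]
  · have : (1 - η) * F y ≤ (1 - η) * ((1 + η) * sInf S) :=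
      mul_le_mul_of_nonneg_left hlt.le (by linarith)
    nlinarith [mul_pos (mul_pos hη hη) hpos]

theorem exists_pos_one_lt_mul_pow {d : ℕ} {r : ℝ} (hr : (d : ℝ) < r) :
    ∃ s : ℝ, 0 < s ∧ s < 1 ∧ 1 < (1 - s ^ 2) * (1 - s) ^ d * (1 + s * r) := by
  have hd : (0 : ℝ) ≤ d := Nat.cast_nonneg d
  have hr0 : 0 < r := hd.trans_lt hr
  have hden : 0 < 1 + d * r + r := by positivity
  set s := min (1 / 2) ((r - d) / (2 * (1 + d * r + r))) with hs
  have hs0 : 0 < s := lt_min (by norm_num) (div_pos (by linarith) (by positivity))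
  have hs1 : s ≤ 1 / 2 := min_le_left _ _
  have hs2 : s * (2 * (1 + d * r + r)) ≤ r - d := by
    rw [← le_div_iff₀ (by positivity)]; exact min_le_right _ _
  refine ⟨s, hs0, by linarith, ?_⟩
  have hB : 1 - d * s ≤ (1 - s) ^ d := by
    have := one_add_mul_le_pow (a := -s) (by linarith) d
    rw [← sub_eq_add_neg] at this
    linarith
  have h1 : 0 < 1 - s ^ 2 := by nlinarith
  have h2 : 0 < 1 + s * r := by positivity
  have h3 : (1 - s ^ 2) * (1 - d * s) * (1 + s * r) ≤ (1 - s ^ 2) * (1 - s) ^ d * (1 + s * r) := by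
    gcongr
  refine lt_of_lt_of_le ?_ h3
  have h4 : (1 - d * s - s ^ 2) * (1 + s * r) ≤ (1 - s ^ 2) * (1 - d * s) * (1 + s * r) := by
    refine mul_le_mul_of_nonneg_right ?_ h2.le
    have : 0 ≤ (d : ℝ) * s ^ 3 := by positivity
    nlinarith
  refine lt_of_lt_of_le ?_ h4
  have h5 : (1 - d * s - s ^ 2) * (1 + s * r) =
      1 + s * ((r - d) - s * (1 + d * r + s * r)) := by ring
  rw [h5]
  have h6 : s * (1 + d * r + s * r) ≤ s * (1 + d * r + r) := by
    gcongr; nlinarith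
  have : 0 < (r - d) - s * (1 + d * r + s * r) := by nlinarith
  nlinarith [mul_pos hs0 this]

theorem exists_scaling_leverage_lt {m d : ℕ} (hd : d ≤ m) {U : Matrix (Fin m) (Fin d) ℝ}
    (hU : ∀ f : Fin d → Fin m, Function.Injective f → (U.submatrix f id).det ≠ 0)
    {r : ℝ} (hr : (d : ℝ) < r) :
    ∃ y : Fin m → ℝ, (∀ a, 0 < y a) ∧
      0 < ((diagonal y * U)ᵀ * (diagonal y * U)).det ∧
      ∀ a, m * ((diagonal y * U) * ((diagonal y * U)ᵀ * (diagonal y * U))⁻¹ *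
        (diagonal y * U)ᵀ) a a < r := by
  obtain ⟨s, hs0, hs1, hs⟩ := exists_pos_one_lt_mul_pow hr
  obtain ⟨y, hy, hP, hmin⟩ := exists_approx_scaling hd hU (pow_pos hs0 2)
  refine ⟨y, hy, hP, fun a => ?_⟩
  by_contra! hcon
  set W := diagonal y * U with hW
  set ℓ := (W * (Wᵀ * W)⁻¹ * Wᵀ) a a with hℓ
  set σ := √(1 - s) with hσ
  have hσ0 : 0 < σ := Real.sqrt_pos.2 (by linarith)
  have hσ2 : σ ^ 2 = 1 - s := Real.sq_sqrt (by linarith)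
  let z := Function.update y a (σ * y a)
  have hz : ∀ b, 0 < z b := fun b => by
    by_cases h : b = a
    · subst h; simpa [z] using mul_pos hσ0 (hy b)
    · simpa [z, h] using hy b
  have hzW : diagonal z * U = W.updateRow a (σ • W a) := by
    ext b j
    by_cases h : b = a
    · subst h; simp [z, hW, Matrix.diagonal_mul, mul_assoc]
    · simp [z, hW, Matrix.diagonal_mul, h]
  have hzp : ∏ b, z b ^ 2 = (1 - s) * ∏ b, y b ^ 2 := by
    rw [← Finset.mul_prod_erase _ _ (Finset.mem_univ a),
      ← Finset.mul_prod_erase _ (fun b => y b ^ 2) (Finset.mem_univ a)]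
    have : ∏ b ∈ Finset.univ.erase a, z b ^ 2 = ∏ b ∈ Finset.univ.erase a, y b ^ 2 :=
      Finset.prod_congr rfl fun b hb => by simp [z, Finset.ne_of_mem_erase hb]
    rw [this, ← mul_assoc]
    simp [z, mul_pow, hσ2]
  have h := hmin z hz
  rw [hzW, Matrix.det_gram_update hP.ne', hzp, hσ2, sub_sub_cancel, ← hℓ, mul_pow, mul_pow] at h
  have hY : 0 < (∏ b, y b ^ 2) ^ d := pow_pos (Finset.prod_pos fun b _ => pow_pos (hy b) 2) d
  have hs' : 0 < (1 - s) ^ d := pow_pos (by linarith) d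
  have hPm : 0 < (Wᵀ * W).det ^ m := pow_pos hP m
  have h1 : (1 - s ^ 2) * (1 - s) ^ d ≤ (1 - s * ℓ) ^ m := by
    have e : (Wᵀ * W).det ^ m * (1 - s * ℓ) ^ m / ((1 - s) ^ d * (∏ b, y b ^ 2) ^ d) =
        ((Wᵀ * W).det ^ m / (∏ b, y b ^ 2) ^ d) * ((1 - s * ℓ) ^ m / (1 - s) ^ d) := by
      field_simp
    rw [e, mul_comm (1 - s ^ 2)] at h
    exact (le_div_iff₀ hs').1 (le_of_mul_le_mul_left h (div_pos hPm hY))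
  have hnn : 0 ≤ 1 - s * ℓ := by
    have hPz : 0 ≤ ((W.updateRow a (σ • W a))ᵀ * W.updateRow a (σ • W a)).det := by
      simpa using (Matrix.posSemidef_conjTranspose_mul_self (W.updateRow a (σ • W a))).det_nonneg
    rw [Matrix.det_gram_update hP.ne', hσ2, sub_sub_cancel] at hPz
    exact nonneg_of_mul_nonneg_right hPz hP
  have h2 : (1 - s * ℓ) ^ m ≤ Real.exp (-(s * (m * ℓ))) := by
    calc (1 - s * ℓ) ^ m ≤ Real.exp (-(s * ℓ)) ^ m :=
          pow_le_pow_left₀ hnn (Real.one_sub_le_exp_neg _) m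
      _ = _ := by rw [← Real.exp_nat_mul]; congr 1; ring
  have h3 : 1 + s * r ≤ Real.exp (s * (m * ℓ)) := by
    have := Real.add_one_le_exp (s * (m * ℓ))
    nlinarith
  have hr0 : 0 < r := (Nat.cast_nonneg d).trans_lt hr
  have h4 : (1 - s ^ 2) * (1 - s) ^ d * (1 + s * r) ≤ 1 := by
    calc _ ≤ Real.exp (-(s * (m * ℓ))) * Real.exp (s * (m * ℓ)) :=
          mul_le_mul (h1.trans h2) h3 (by positivity) (Real.exp_pos _).le
      _ = 1 := by rw [← Real.exp_add]; simp
  linarith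

/-- Some arbitrarily small perturbations of `U` are in general position. -/
theorem eventually_det_submatrix_add_smul_vandermonde_ne_zero {m d : ℕ}
    (U : Matrix (Fin m) (Fin d) ℝ) :
    ∀ᶠ ε in nhdsWithin (0 : ℝ) {0}ᶜ, ∀ f : Fin d → Fin m, Function.Injective f →
      ((U + ε • Matrix.of fun (a : Fin m) (j : Fin d) => ((a : ℕ) : ℝ) ^ (j : ℕ)).submatrix f id).det ≠ 0 := by
  set Z : Matrix (Fin m) (Fin d) ℝ := Matrix.of fun a j => ((a : ℕ) : ℝ) ^ (j : ℕ) with hZ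
  rw [Filter.eventually_all]
  intro f
  rw [Filter.eventually_imp_distrib_left]
  intro hf
  have hv : (Z.submatrix f id).det ≠ 0 := by
    have : Z.submatrix f id = Matrix.vandermonde fun i => ((f i : ℕ) : ℝ) := by
      ext i j; simp [hZ, Matrix.vandermonde]
    rw [this, Matrix.det_vandermonde_ne_zero_iff]
    exact fun i j h => hf (Fin.ext (Nat.cast_injective h))
  set M := -((Z.submatrix f id)⁻¹ * U.submatrix f id) with hM
  have hfin : (M.charpoly.roots.toFinset : Set ℝ).Finite := Finset.finite_toSet _
  filter_upwards [nhdsNE_le_cofinite (0 : ℝ) hfin.compl_mem_cofinite] with ε hε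
  have e : (U + ε • Z).submatrix f id = Z.submatrix f id * (scalar (Fin d) ε - M) := by
    rw [hM, sub_neg_eq_add, Matrix.mul_add, ← Matrix.mul_assoc,
      Matrix.mul_nonsing_inv _ (isUnit_iff_ne_zero.2 hv), Matrix.one_mul]
    ext i j
    simp [mul_comm, add_comm]
  rw [e, Matrix.det_mul, ← Matrix.eval_charpoly]
  refine mul_ne_zero hv fun h0 => hε ?_
  simp [(Matrix.charpoly_monic M).ne_zero, Polynomial.IsRoot, h0]

/-- **Forster's theorem** for Hadamard matrices. -/
theorem sqrt_le_of_sign_eq_hadamard {m d : ℕ} (hm : 0 < m) {H : Matrix (Fin m) (Fin m) ℝ}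
    (hH : ∀ a b, |H a b| = 1) (hHH : H * Hᵀ = (m : ℝ) • (1 : Matrix (Fin m) (Fin m) ℝ))
    (U : Matrix (Fin m) (Fin d) ℝ) (V : Matrix (Fin d) (Fin m) ℝ)
    (hpos : ∀ a b, 0 < H a b * (U * V) a b) : √(m : ℝ) ≤ d := by
  by_contra! hlt
  have hm1 : (1 : ℝ) ≤ m := by exact_mod_cast hm
  have hdm : d ≤ m := by
    have h1 : √(m : ℝ) ≤ m := by
      rw [Real.sqrt_le_left (by linarith)]; nlinarith
    exact_mod_cast (hlt.trans_le h1).le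
  let Z : Matrix (Fin m) (Fin d) ℝ := Matrix.of fun a j => ((a : ℕ) : ℝ) ^ (j : ℕ)
  have hev : ∀ᶠ ε in nhdsWithin (0 : ℝ) {0}ᶜ, ∀ a b, 0 < H a b * ((U + ε • Z) * V) a b := by
    refine nhdsWithin_le_nhds ?_
    refine Filter.eventually_all.2 fun a => Filter.eventually_all.2 fun b => ?_
    have hc : Continuous fun ε : ℝ => H a b * ((U + ε • Z) * V) a b := by
      simp only [Matrix.add_mul, Matrix.smul_mul, Matrix.add_apply, Matrix.smul_apply, smul_eq_mul]
      fun_prop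
    refine hc.continuousAt.eventually (lt_mem_nhds ?_)
    simpa using hpos a b
  obtain ⟨ε, hgen, hpos'⟩ :=
    ((eventually_det_submatrix_add_smul_vandermonde_ne_zero U).and hev).exists
  obtain ⟨y, hy, hP, hlev⟩ := exists_scaling_leverage_lt hdm hgen hlt
  set U' := U + ε • Z with hU'
  change 0 < ((diagonal y * U')ᵀ * (diagonal y * U')).det at hP
  change ∀ a, m * ((diagonal y * U') * ((diagonal y * U')ᵀ * (diagonal y * U'))⁻¹ *
        (diagonal y * U')ᵀ) a a < √(m : ℝ) at hlev
  set W := diagonal y * U' with hW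
  clear_value W
  have hu : IsUnit (Wᵀ * W).det := isUnit_iff_ne_zero.2 hP.ne'
  set K := W * (Wᵀ * W)⁻¹ * Wᵀ with hK
  have hKW : K * W = W := by
    rw [hK, Matrix.mul_assoc, Matrix.mul_assoc, Matrix.nonsing_inv_mul _ hu, Matrix.mul_one]
  have hKs : Kᵀ = K := by
    simp only [hK, Matrix.transpose_mul, Matrix.transpose_transpose, Matrix.transpose_nonsing_inv,
      Matrix.mul_assoc]
  have hKK : K * K = K := by
    conv_lhs => rw [hK, ← Matrix.mul_assoc, ← Matrix.mul_assoc, ← hK, hKW]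
  have hone := Matrix.one_le_sum_sq_diag_of_isIdempotent (Y := W * V) hm hKs hKK
    (by rw [← Matrix.mul_assoc, hKW]) hH hHH (fun a b => by
      rw [hW, Matrix.mul_assoc, Matrix.diagonal_mul, mul_left_comm]
      exact mul_pos (hy a) (hpos' a b))
  have hKnn : ∀ a, 0 ≤ K a a := fun a => by
    have := congrFun (congrFun hKK a) a
    rw [Matrix.mul_apply] at this
    rw [← this]
    refine Finset.sum_nonneg fun c _ => ?_
    rw [← congrFun (congrFun hKs c) a, Matrix.transpose_apply]
    exact mul_self_nonneg _
  have hlt' : ∑ a, ((m : ℝ) * K a a) ^ 2 < ∑ _a : Fin m, (m : ℝ) := by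
    refine Finset.sum_lt_sum_of_nonempty ⟨⟨0, hm⟩, Finset.mem_univ _⟩ fun a _ => ?_
    calc ((m : ℝ) * K a a) ^ 2 < √(m : ℝ) ^ 2 :=
          pow_lt_pow_left₀ (hlev a) (mul_nonneg (by linarith) (hKnn a)) two_ne_zero
      _ = m := Real.sq_sqrt (by linarith)
  simp only [mul_pow, ← Finset.mul_sum, Finset.sum_const, Finset.card_univ, Fintype.card_fin,
    nsmul_eq_mul] at hlt'
  nlinarith

end SignRank

theorem dbl_inj {m : ℕ} {a a' : Fin m} {t t' : Fin 2} : dbl a t = dbl a' t' ↔ a = a' ∧ t = t' := by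
  simp only [dbl, Fin.ext_iff]
  omega

theorem mem_pairF {m : ℕ} {a : Fin m} {i : Fin (2 * m)} : i ∈ pairF a ↔ ∃ t, i = dbl a t := by
  simp [pairF, Fin.exists_fin_two]

theorem dbl_mem_pairF {m : ℕ} {a a' : Fin m} {t : Fin 2} : dbl a t ∈ pairF a' ↔ a = a' := by
  simp [mem_pairF, dbl_inj]

theorem pairF_injective {m : ℕ} : Function.Injective (pairF (m := m)) := fun a a' h => by
  have : dbl a 0 ∈ pairF a' := h ▸ dbl_mem_pairF.2 rfl
  exact dbl_mem_pairF.1 this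

/-- The 2-regular data set whose observed choices in block `(a, b)` are the profiles `(s, t)`
with `t = s + off a b`. -/
def blockData {m : ℕ} (off : Fin m → Fin m → Fin 2) : Finset (Obs (2 * m)) :=
  Finset.univ.image fun q : Fin m × Fin m × Fin 2 =>
    ((dbl q.1 q.2.2, dbl q.2.1 (q.2.2 + off q.1 q.2.1)), pairF q.1, pairF q.2.1)

theorem mem_blockData {m : ℕ} {off : Fin m → Fin m → Fin 2} {o : Obs (2 * m)} :
    o ∈ blockData off ↔
      ∃ a b s, ((dbl a s, dbl b (s + off a b)), pairF a, pairF b) = o := by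
  simp [blockData]

theorem isDataset_blockData {m : ℕ} (off : Fin m → Fin m → Fin 2) : IsDataset (blockData off) := by
  intro o ho
  obtain ⟨a, b, s, rfl⟩ := mem_blockData.1 ho
  exact ⟨dbl_mem_pairF.2 rfl, dbl_mem_pairF.2 rfl⟩

theorem twoRegular_blockData {m : ℕ} (off : Fin m → Fin m → Fin 2) :
    TwoRegular (blockData off) := by
  refine ⟨fun o ho => ?_, fun a b => ?_⟩
  · obtain ⟨a, b, s, rfl⟩ := mem_blockData.1 ho
    exact ⟨a, b, rfl⟩
  · have h : {p : Fin (2 * m) × Fin (2 * m) | (p, pairF a, pairF b) ∈ blockData off} =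
        {(dbl a 0, dbl b (0 + off a b)), (dbl a 1, dbl b (1 + off a b))} := by
      ext p
      simp only [Set.mem_ofPred_eq, mem_blockData, Prod.mk.injEq, pairF_injective.eq_iff,
        Set.mem_insert_iff, Set.mem_singleton_iff]
      constructor
      · rintro ⟨a, b, s, rfl, rfl, rfl⟩
        fin_cases s
        · exact Or.inl rfl
        · exact Or.inr rfl
      · rintro (rfl | rfl)
        · exact ⟨a, b, 0, rfl, rfl, rfl⟩
        · exact ⟨a, b, 1, rfl, rfl, rfl⟩
    rw [h]
    generalize off a b = t
    fin_cases t
    · exact Or.inl rfl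
    · exact Or.inr rfl

theorem laminar_blockData {m : ℕ} (off : Fin m → Fin m → Fin 2) : Laminar (blockData off) := by
  rintro o ho o' ho' ⟨⟨p, hp⟩, hsub, -⟩
  obtain ⟨a, b, s, rfl⟩ := mem_blockData.1 ho
  obtain ⟨a', b', s', rfl⟩ := mem_blockData.1 ho'
  simp only [Finset.mem_inter, Finset.mem_product, mem_pairF] at hp
  obtain ⟨⟨⟨t, ht⟩, ⟨u, hu⟩⟩, ⟨t', ht'⟩, ⟨u', hu'⟩⟩ := hp
  obtain ⟨rfl, -⟩ := dbl_inj.1 (ht.symm.trans ht')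
  obtain ⟨rfl, -⟩ := dbl_inj.1 (hu.symm.trans hu')
  exact hsub subset_rfl

theorem rationalizable_blockData {m : ℕ} (off : Fin m → Fin m → Fin 2) :
    Rationalizable (blockData off) := by
  classical
  let A : Matrix (Fin (2 * m)) (Fin (2 * m)) ℝ :=
    Matrix.of fun i j => if ∃ a b s, i = dbl a s ∧ j = dbl b (s + off a b) then 1 else 0
  have hA : ∀ a b s t, A (dbl a s) (dbl b t) = if t = s + off a b then 1 else 0 := by
    intro a b s t
    simp only [A, Matrix.of_apply]
    congr 1
    simp only [dbl_inj, eq_iff_iff]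
    constructor
    · rintro ⟨a, b, s, ⟨rfl, rfl⟩, rfl, h⟩; exact h
    · intro h; exact ⟨a, b, s, ⟨rfl, rfl⟩, rfl, h⟩
  refine ⟨A, A, fun o ho => ?_⟩
  obtain ⟨a, b, s, rfl⟩ := mem_blockData.1 ho
  refine ⟨dbl_mem_pairF.2 rfl, dbl_mem_pairF.2 rfl, fun i hi hne => ?_, fun j hj hne => ?_⟩
  · obtain ⟨t, rfl⟩ := mem_pairF.1 hi
    have : s ≠ t := fun h => hne (by rw [h])
    simp [hA, this]
  · obtain ⟨t, rfl⟩ := mem_pairF.1 hj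
    have : t ≠ s + off a b := fun h => hne (by rw [h])
    simp [hA, this]

theorem Rationalizes.block_sum_pos {m : ℕ} {off : Fin m → Fin m → Fin 2}
    {A B : Matrix (Fin (2 * m)) (Fin (2 * m)) ℝ} (h : Rationalizes A B (blockData off))
    (a b : Fin m) :
    0 < (if off a b = 0 then 1 else -1) *
      ((A + B) (dbl a 0) (dbl b 0) - (A + B) (dbl a 0) (dbl b 1) -
        (A + B) (dbl a 1) (dbl b 0) + (A + B) (dbl a 1) (dbl b 1)) := by
  have hN : ∀ s, StrictNash A B (pairF a) (pairF b) (dbl a s) (dbl b (s + off a b)) :=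
    fun s => h _ (mem_blockData.2 ⟨a, b, s, rfl⟩)
  have hA : ∀ s t, t ≠ s → A (dbl a t) (dbl b (s + off a b)) < A (dbl a s) (dbl b (s + off a b)) :=
    fun s t hst => (hN s).2.2.1 _ (dbl_mem_pairF.2 rfl) fun e => hst (dbl_inj.1 e).2
  have hB : ∀ s t, t ≠ s + off a b → B (dbl a s) (dbl b t) < B (dbl a s) (dbl b (s + off a b)) :=
    fun s t hst => (hN s).2.2.2 _ (dbl_mem_pairF.2 rfl) fun e => hst (dbl_inj.1 e).2
  simp only [Matrix.add_apply]
  generalize off a b = t at hA hB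
  have hA0 := hA 0 1 (by decide)
  have hA1 := hA 1 0 (by decide)
  fin_cases t
  · have hB0 := hB 0 1 (by decide)
    have hB1 := hB 1 0 (by decide)
    simp at hA0 hA1 hB0 hB1 ⊢
    linarith
  · have hB0 := hB 0 0 (by decide)
    have hB1 := hB 1 1 (by decide)
    have e : (1 : Fin 2) + 1 = 0 := by decide
    simp [e] at hA0 hA1 hB0 hB1 ⊢
    linarith

/-- For every `k ≥ 1` and `n = 2^(k+1) = 2 * 2^k`, there exists a
rationalizable laminar data set `T` over an `n × n` strategy space — namely a 2-regular
data set, whose subgames are pairwise disjoint — such that every bimatrix game `(A,B)`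
that rationalizes `T` satisfies `rank (A+B) ≥ √(n/2)`. -/
theorem high_rank_laminar_datasets_exist (k : ℕ) (hk : 1 ≤ k) :
    ∃ T : Finset (Obs (2 * 2 ^ k)), IsDataset T ∧ TwoRegular T ∧ Laminar T ∧
      Rationalizable T ∧
      ∀ A B : Matrix (Fin (2 * 2 ^ k)) (Fin (2 * 2 ^ k)) ℝ, Rationalizes A B T →
        Real.sqrt (((2 * 2 ^ k : ℕ) : ℝ) / 2) ≤ ((A + B).rank : ℝ) := by
  obtain ⟨H, hH, hHH⟩ := exists_hadamard k
  refine ⟨blockData fun a b => if H a b = 1 then 0 else 1, isDataset_blockData _,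
    twoRegular_blockData _, laminar_blockData _, rationalizable_blockData _, fun A B hAB => ?_⟩
  obtain ⟨U, V, hUV⟩ := (A + B).exists_eq_mul_of_rank
  have hn : (((2 * 2 ^ k : ℕ) : ℝ) / 2) = ((2 ^ k : ℕ) : ℝ) := by push_cast; ring
  rw [hn]
  refine sqrt_le_of_sign_eq_hadamard (by positivity) (fun a b => ?_) hHH
    (Matrix.of fun a j => U (dbl a 0) j - U (dbl a 1) j)
    (Matrix.of fun j b => V j (dbl b 0) - V j (dbl b 1)) fun a b => ?_
  · rcases hH a b with h | h <;> simp [h]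
  · have h1 := hAB.block_sum_pos a b
    have h2 : (if (if H a b = 1 then (0 : Fin 2) else 1) = 0 then (1 : ℝ) else -1) = H a b := by
      rcases hH a b with h | h
      · simp [h]
      · norm_num [h]
    rw [h2] at h1
    convert h1 using 2
    have hC : ∀ i j, (A + B) i j = ∑ x, U i x * V x j := fun i j => by
      rw [← Matrix.mul_apply, ← hUV]
    rw [hC, hC, hC, hC, Matrix.mul_apply, ← Finset.sum_sub_distrib, ← Finset.sum_sub_distrib,
      ← Finset.sum_add_distrib]
    refine Finset.sum_congr rfl fun x _ => ?_
    simp only [Matrix.of_apply]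
    ring
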